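/- arXiv:2007.11535 — 2 statements merged into one kernel-verified Lean document; each statement's English description precedes it below -/
import Mathlib

section
/- Let R be a commutative ring, d ≥ 1, a_0 a unit of R, and a_1, …, a_{d-1} ∈ R. Let p(X) = X^d − a_{d-1}X^{d-1} − ⋯ − a_1X − a_0 ∈ R[X], let H = R[X]/(p) and let s denote the image of X in H, so that (1, s, …, s^{d-1}) is an R-basis of H. Let τ : H → R be the R-linear map whose value on an element of H is the coordinate of that element at the basis vector 1 (i.e. τ(s^j) = δ_{0,j} for 0 ≤ j ≤ d−1). Then the d×d Gram matrix A = (τ(s^{i+j}))_{0 ≤ i,j ≤ d−1} has determinant det(A) = (−1)^{(d−1)(d−2)/2} a_0^{d−1}; in particular det(A) is a unit of R. -/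
open Polynomial

/-- The determinant of a matrix that vanishes above the antidiagonal and is constant on it. -/
theorem Matrix.det_of_antitriangular {R : Type*} [CommRing R] (c : R) :
    ∀ (n : ℕ) (M : Matrix (Fin n) (Fin n) R),
      (∀ i j : Fin n, (i : ℕ) + j + 1 < n → M i j = 0) →
      (∀ i j : Fin n, (i : ℕ) + j + 1 = n → M i j = c) →
      M.det = (-1) ^ (n * (n - 1) / 2) * c ^ n
  | 0, M, _, _ => by simp
  | n + 1, M, h0, hc => by
    rw [Matrix.det_succ_row_zero, Fin.sum_univ_castSucc, Finset.sum_eq_zero, zero_add,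
      Fin.succAbove_last, hc 0 (Fin.last n) (by simp),
      Matrix.det_of_antitriangular c n (M.submatrix Fin.succ Fin.castSucc)
        (fun i j h => h0 _ _ (by simp; omega)) (fun i j h => hc _ _ (by simp; omega)),
      Nat.triangle_succ, Fin.val_last]
    · ring
    · intro j _
      rw [h0 0 j.castSucc (by simp), mul_zero, zero_mul]

/-- Let `R` be a commutative ring, `d ≥ 1`, `a 0` a unit of `R`, and
`p = X^d - a_{d-1}X^{d-1} - ⋯ - a_1X - a_0 ∈ R[X]`.  Let `H = R[X]/(p)` and let `s` be the
image of `X`.  If `τ : H → R` is the `R`-linear map with `τ(sʲ) = δ_{0,j}` for `0 ≤ j ≤ d-1`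
(the coordinate at the basis vector `1` of the power basis), then the Gram matrix
`A = (τ(s^{i+j}))` has determinant `(-1)^{(d-1)(d-2)/2} a₀^{d-1}`, which is a unit of `R`. -/
theorem gram_det_cyclic_hecke (R : Type*) [CommRing R] (d : ℕ) (hd : 0 < d)
    (a : Fin d → R) (ha : IsUnit (a ⟨0, hd⟩))
    (p : R[X]) (hp : p = X ^ d - ∑ i : Fin d, C (a i) * X ^ (i : ℕ))
    (τ : AdjoinRoot p →ₗ[R] R)
    (hτ : ∀ j : Fin d, τ (AdjoinRoot.root p ^ (j : ℕ)) = if (j : ℕ) = 0 then 1 else 0) :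
    (Matrix.of fun i j : Fin d => τ (AdjoinRoot.root p ^ ((i : ℕ) + (j : ℕ)))).det =
        (-1) ^ ((d - 1) * (d - 2) / 2) * a ⟨0, hd⟩ ^ (d - 1) ∧
      IsUnit (Matrix.of fun i j : Fin d => τ (AdjoinRoot.root p ^ ((i : ℕ) + (j : ℕ)))).det := by
  obtain ⟨n, rfl⟩ : ∃ n, d = n + 1 := ⟨d - 1, by omega⟩
  have root_pow : AdjoinRoot.root p ^ (n + 1) =
      ∑ i : Fin (n + 1), a i • AdjoinRoot.root p ^ (i : ℕ) := by
    have h := congrArg (Polynomial.aeval (AdjoinRoot.root p)) hp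
    rw [AdjoinRoot.aeval_eq, AdjoinRoot.mk_self, eq_comm, map_sub, sub_eq_zero] at h
    simpa [Algebra.smul_def] using h
  have tau_eq_zero (k : ℕ) (hk : k ≠ 0) (hkn : k < n + 1) : τ (AdjoinRoot.root p ^ k) = 0 := by
    simpa [hk] using hτ ⟨k, hkn⟩
  have tau_top : τ (AdjoinRoot.root p ^ (n + 1)) = a 0 := by
    simp [root_pow, hτ, Fin.val_eq_zero_iff]
  have det_eq : (Matrix.of fun i j : Fin (n + 1) =>
      τ (AdjoinRoot.root p ^ ((i : ℕ) + (j : ℕ)))).det = (-1) ^ (n * (n - 1) / 2) * a 0 ^ n := by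
    rw [Matrix.det_succ_row_zero, Fin.sum_univ_succ, Finset.sum_eq_zero, add_zero,
      Matrix.det_of_antitriangular (a 0)]
    · have h := hτ 0
      simp only [Fin.val_zero, pow_zero, if_true] at h
      simp [h]
    · intro i j h
      exact tau_eq_zero _ (by simp) (by simp; omega)
    · intro i j h
      rw [← tau_top]
      simp only [Matrix.submatrix_apply, Matrix.of_apply, Fin.zero_succAbove, Fin.val_succ]
      congr 2
      omega
    · intro j _
      rw [Matrix.of_apply, tau_eq_zero _ (by simp) (by simp), mul_zero, zero_mul]
  refine ⟨det_eq, ?_⟩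
  rw [det_eq]
  exact (isUnit_one.neg.pow _).mul (ha.pow n)
end

section
/- Let R be a commutative ring, d ≥ 1, a_0 a unit of R, and a_1, …, a_{d-1} ∈ R. Let H = R[X]/(X^d − a_{d-1}X^{d-1} − ⋯ − a_1X − a_0), let s be the image of X, and let τ : H → R be the R-linear map with τ(s^j) = δ_{0,j} for 0 ≤ j ≤ d−1 (coordinate at 1 in the power basis). Then τ is a symmetrising trace on H: τ(h_1h_2) = τ(h_2h_1) for all h_1, h_2 ∈ H, and the R-bilinear form (h_1, h_2) ↦ τ(h_1h_2) is a perfect pairing, i.e. the induced R-linear map H → Hom_R(H, R), h ↦ (h' ↦ τ(hh')), is bijective. -/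
open Polynomial

/-- Let `H` be a finite free commutative algebra spanned by the first `d` powers of a unit `u`.
A linear form on `H` that takes the value `1` at `1` and vanishes at `u ^ j` for `0 < j < d`
induces a bijection from `H` onto its dual. -/
theorem bijective_comp_mulLeft_of_apply_pow {R H : Type*} [CommRing R] [CommRing H] [Algebra R H]
    [Module.Free R H] [Module.Finite R H] (d : ℕ) (u : Hˣ) (τ : H →ₗ[R] R)
    (hu : ∀ f g : H →ₗ[R] R, (∀ i : Fin d, f ((u : H) ^ (i : ℕ)) = g ((u : H) ^ (i : ℕ))) → f = g)
    (hτ : ∀ j < d, τ ((u : H) ^ j) = if j = 0 then 1 else 0) :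
    Function.Bijective fun h : H => τ ∘ₗ LinearMap.mulLeft R h := by
  let Φ : H →ₗ[R] Module.Dual R H := LinearMap.compr₂ (LinearMap.mul R H) τ
  suffices hΦ : Function.Surjective Φ by
    let e := (Module.Free.chooseBasis R H).toDualEquiv
    have hinj : Function.Injective (e.symm.toLinearMap ∘ₗ Φ) :=
      OrzechProperty.injective_of_surjective_endomorphism _ (e.symm.surjective.comp hΦ)
    exact ⟨Function.Injective.of_comp (f := e.symm) hinj, hΦ⟩
  intro f
  let M : Matrix (Fin d) (Fin d) R :=
    fun i j => τ (((u⁻¹ : Hˣ) : H) ^ (j : ℕ) * (u : H) ^ (i : ℕ))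
  have hM : ∀ i j : Fin d, j ≤ i → M i j = if i = j then 1 else 0 := by
    intro i j hij
    have hpow : ((u⁻¹ : Hˣ) : H) ^ (j : ℕ) * (u : H) ^ (i : ℕ) = (u : H) ^ ((i : ℕ) - j) := by
      obtain ⟨k, hk⟩ := Nat.exists_eq_add_of_le (Fin.le_def.mp hij)
      rw [hk, pow_add, ← mul_assoc, ← mul_pow, Units.inv_mul, one_pow, one_mul,
        Nat.add_sub_cancel_left]
    simp only [M, hpow]
    rw [hτ _ (by omega)]
    congr 1
    simp only [Fin.ext_iff, eq_iff_iff]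
    rw [Fin.le_def] at hij
    omega
  have hdet : M.det = 1 := by
    rw [Matrix.det_of_isUpperTriangular fun i j hij =>
      (hM i j (le_of_lt hij)).trans (if_neg (ne_of_gt hij))]
    exact Finset.prod_eq_one fun i _ => by rw [hM i i le_rfl, if_pos rfl]
  let c : Fin d → R := fun i => f ((u : H) ^ (i : ℕ))
  have hx : M.mulVec (M⁻¹.mulVec c) = c := by
    rw [Matrix.mulVec_mulVec, Matrix.mul_nonsing_inv _ (by simp [hdet]), Matrix.one_mulVec]
  refine ⟨∑ j, (M⁻¹.mulVec c) j • ((u⁻¹ : Hˣ) : H) ^ (j : ℕ), hu _ _ fun i => ?_⟩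
  refine Eq.trans ?_ (congrFun hx i)
  simp [Φ, M, Matrix.mulVec, dotProduct, mul_comm]

/-- Let `R` be a commutative ring, `d ≥ 1`, `a 0` a unit of `R`, and
`H = R[X]/(X^d - a_{d-1}X^{d-1} - ⋯ - a_1X - a_0)`, with `s` the image of `X`.  If
`τ : H → R` is the `R`-linear map with `τ(sʲ) = δ_{0,j}` for `0 ≤ j ≤ d-1`, then `τ` is a
symmetrising trace on `H`: it is a trace map, and the induced map
`H → Hom_R(H, R)`, `h ↦ (h' ↦ τ(hh'))`, is bijective. -/
theorem cyclic_hecke_symmetrising_trace (R : Type*) [CommRing R] (d : ℕ) (hd : 0 < d)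
    (a : Fin d → R) (ha : IsUnit (a ⟨0, hd⟩))
    (p : R[X]) (hp : p = X ^ d - ∑ i : Fin d, C (a i) * X ^ (i : ℕ))
    (τ : AdjoinRoot p →ₗ[R] R)
    (hτ : ∀ j : Fin d, τ (AdjoinRoot.root p ^ (j : ℕ)) = if (j : ℕ) = 0 then 1 else 0) :
    (∀ h₁ h₂ : AdjoinRoot p, τ (h₁ * h₂) = τ (h₂ * h₁)) ∧
      Function.Bijective fun h : AdjoinRoot p => τ ∘ₗ LinearMap.mulLeft R h := by
  refine ⟨fun h₁ h₂ => by rw [mul_comm], ?_⟩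
  have hdeg : (∑ i : Fin d, C (a i) * X ^ (i : ℕ)).degree < (d : WithBot ℕ) := degree_sum_fin_lt a
  have hmonic : p.Monic := hp ▸ monic_X_pow_sub hdeg
  have hnat : p.natDegree ≤ d := by
    rw [hp]
    refine (natDegree_sub_le _ _).trans (max_le (natDegree_X_pow_le d) ?_)
    exact natDegree_le_of_degree_le hdeg.le
  have hcoeff : p.coeff 0 = -a ⟨0, hd⟩ := by
    rw [hp, coeff_sub, coeff_X_pow, if_neg hd.ne, finsetSum_coeff,
      Finset.sum_eq_single ⟨0, hd⟩]
    · simp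
    · intro i _ hi
      rw [coeff_C_mul_X_pow, if_neg]
      exact fun h => hi (Fin.ext h.symm)
    · simp
  have hunit : IsUnit (AdjoinRoot.root p) := by
    have hdvd := map_dvd (AdjoinRoot.mk p) (X_dvd_sub_C (p := p))
    rw [hcoeff, map_sub, AdjoinRoot.mk_self, AdjoinRoot.mk_X, AdjoinRoot.mk_C, zero_sub, dvd_neg]
      at hdvd
    exact isUnit_of_dvd_unit hdvd (ha.neg.map _)
  obtain ⟨u, hu⟩ := hunit
  let b := AdjoinRoot.powerBasis' hmonic
  have : Module.Free R (AdjoinRoot p) := Module.Free.of_basis b.basis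
  have : Module.Finite R (AdjoinRoot p) := b.finite
  refine bijective_comp_mulLeft_of_apply_pow d u τ (fun f g hfg => b.basis.ext fun i => ?_)
    fun j hj => hu ▸ hτ ⟨j, hj⟩
  rw [b.basis_eq_pow]
  have hgen : b.gen = u := hu.symm
  rw [hgen]
  exact hfg ⟨i, i.isLt.trans_le hnat⟩
end
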